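/- Lipschitz continuity of the smoothed Knight remainder functionals on bounded sets: for every B > 0 there exists a constant C > 0, depending only on B, such that for every δ with 0 < δ ≤ 1 and all real numbers x, x', y, y', z, z' with |y| ≤ B, |y'| ≤ B, |z| ≤ B, |z'| ≤ B, one has |μ_δ^U(x,y,z) − μ_δ^U(x',y',z')| ≤ C·(|y − y'| + |z − z'| + |x − x'|/δ) and |μ_δ^L(x,y,z) − μ_δ^L(x',y',z')| ≤ C·(|y − y'| + |z − z'| + |x − x'|/δ). -/

import Mathlib

/-- Lower smoothed indicator `1_δ^L`. -/
noncomputable def indL (δ x : ℝ) : ℝ :=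
  (1 - min (x / δ) 1) * (if 0 < x then 1 else 0) + (if x ≤ 0 then 1 else 0)

/-- Upper smoothed indicator `1_δ^U`. -/
noncomputable def indU (δ x : ℝ) : ℝ :=
  (1 - min (x / δ + 1) 1) * (if 0 < x + δ then 1 else 0) + (if x + δ ≤ 0 then 1 else 0)

/-- Knight remainder functional `μ(x,y,z)`. -/
noncomputable def muFn (x y z : ℝ) : ℝ :=
  z * y * ∫ s in (0:ℝ)..1, ((if x ≤ y * s then (1:ℝ) else 0) - (if x ≤ 0 then 1 else 0))

/-- Upper smoothed Knight remainder functional `μ_δ^U(x,y,z)`. -/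
noncomputable def muU (δ x y z : ℝ) : ℝ :=
  z * y * ∫ s in (0:ℝ)..1, ((if x ≤ y * s then (1:ℝ) else 0) - indU δ x)

/-- Lower smoothed Knight remainder functional `μ_δ^L(x,y,z)`. -/
noncomputable def muL (δ x y z : ℝ) : ℝ :=
  z * y * ∫ s in (0:ℝ)..1, ((if x ≤ y * s then (1:ℝ) else 0) - indL δ x)

lemma mul_integral_indicator_eq (x y : ℝ) :
    y * ∫ s in (0:ℝ)..1, (if x ≤ y * s then (1:ℝ) else 0) = max (y - x) 0 - max (-x) 0 := by
  have hmono : Monotone fun u : ℝ => if x ≤ u then (1:ℝ) else 0 := by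
    intro a b hab
    dsimp only
    split_ifs <;> linarith
  have hcont : Continuous fun u : ℝ => max (u - x) 0 := by fun_prop
  rw [intervalIntegral.mul_integral_comp_mul_left (f := fun u : ℝ => if x ≤ u then (1:ℝ) else 0),
    mul_zero, mul_one,
    MeasureTheory.integral_eq_of_hasDerivAt_off_countable (fun u : ℝ => max (u - x) 0) _
      (Set.countable_singleton x) hcont.continuousOn _ hmono.intervalIntegrable]
  · simp
  rintro u ⟨-, hu⟩
  rcases lt_or_gt_of_ne hu with h | h
  · rw [if_neg h.not_ge]
    refine (hasDerivAt_const u (0:ℝ)).congr_of_eventuallyEq ?_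
    filter_upwards [gt_mem_nhds h] with v hv
    exact max_eq_right (by linarith)
  · rw [if_pos h.le]
    refine ((hasDerivAt_id u).sub_const x).congr_of_eventuallyEq ?_
    filter_upwards [lt_mem_nhds h] with v hv
    exact max_eq_left (by linarith)

lemma mul_integral_indicator_sub_eq (x y c : ℝ) :
    y * ∫ s in (0:ℝ)..1, ((if x ≤ y * s then (1:ℝ) else 0) - c) =
      max (y - x) 0 - max (-x) 0 - y * c := by
  have hint : IntervalIntegrable (fun s : ℝ => if x ≤ y * s then (1:ℝ) else 0)
      MeasureTheory.volume 0 1 := by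
    rcases le_total 0 y with hy | hy
    · refine Monotone.intervalIntegrable fun a b hab => ?_
      have := mul_le_mul_of_nonneg_left hab hy
      split_ifs <;> linarith
    · refine Antitone.intervalIntegrable fun a b hab => ?_
      have := mul_le_mul_of_nonpos_left hab hy
      split_ifs <;> linarith
  rw [intervalIntegral.integral_sub hint intervalIntegrable_const, mul_sub,
    mul_integral_indicator_eq]
  simp

lemma indL_eq {δ : ℝ} (hδ : 0 < δ) (x : ℝ) : indL δ x = 1 - max 0 (min (x / δ) 1) := by
  unfold indL
  rcases le_or_gt x 0 with h | h
  · have h' : min (x / δ) 1 ≤ 0 := (min_le_left _ _).trans (div_nonpos_of_nonpos_of_nonneg h hδ.le)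
    simp [h, h.not_gt, max_eq_left h']
  · have h' : 0 ≤ min (x / δ) 1 := le_min (by positivity) zero_le_one
    simp [h, h.not_ge, max_eq_right h']

lemma indU_eq_indL {δ : ℝ} (hδ : 0 < δ) (x : ℝ) : indU δ x = indL δ (x + δ) := by
  unfold indU indL
  rw [add_div, div_self hδ.ne']

lemma abs_indL_le_one {δ : ℝ} (hδ : 0 < δ) (x : ℝ) : |indL δ x| ≤ 1 := by
  rw [indL_eq hδ, abs_le]
  have h₀ := le_max_left 0 (min (x / δ) 1)
  have h₁ : max 0 (min (x / δ) 1) ≤ 1 := max_le zero_le_one (min_le_right _ _)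
  constructor <;> linarith

lemma abs_indL_sub_le {δ : ℝ} (hδ : 0 < δ) (x x' : ℝ) :
    |indL δ x - indL δ x'| ≤ |x - x'| / δ := by
  rw [indL_eq hδ, indL_eq hδ, sub_sub_sub_cancel_left, abs_sub_comm]
  calc |max 0 (min (x / δ) 1) - max 0 (min (x' / δ) 1)|
      ≤ |min (x / δ) 1 - min (x' / δ) 1| := by
        simpa using abs_max_sub_max_le_max 0 (min (x / δ) 1) 0 (min (x' / δ) 1)
    _ ≤ |x / δ - x' / δ| := by simpa using abs_min_sub_min_le_max (x / δ) 1 (x' / δ) 1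
    _ = |x - x'| / δ := by rw [← sub_div, abs_div, abs_of_pos hδ]

lemma abs_mul_integral_sub_le {B δ : ℝ} (hδ : 0 < δ) (hδ1 : δ ≤ 1) {x x' y y' z z' c c' : ℝ}
    (hy : |y| ≤ B) (hy' : |y'| ≤ B) (hz : |z| ≤ B) (hc' : |c'| ≤ 1)
    (hcc : |c - c'| ≤ |x - x'| / δ) :
    |z * y * (∫ s in (0:ℝ)..1, ((if x ≤ y * s then (1:ℝ) else 0) - c)) -
        z' * y' * ∫ s in (0:ℝ)..1, ((if x' ≤ y' * s then (1:ℝ) else 0) - c')| ≤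
      (2 * B + B ^ 2) * (|y - y'| + |z - z'| + |x - x'| / δ) := by
  rw [mul_assoc, mul_assoc, mul_integral_indicator_sub_eq, mul_integral_indicator_sub_eq]
  have hB : 0 ≤ B := (abs_nonneg y).trans hy
  have hx : |x - x'| ≤ |x - x'| / δ := le_div_self (abs_nonneg _) hδ hδ1
  set D := |x - x'| / δ
  have hmax (a b : ℝ) : |max a 0 - max b 0| ≤ |a - b| := by
    simpa using abs_max_sub_max_le_max a 0 b 0
  have h₁ : |max (y - x) 0 - max (y' - x') 0| ≤ |y - y'| + |x - x'| :=
    (hmax _ _).trans (by rw [sub_sub_sub_comm]; exact abs_sub _ _)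
  have h₂ : |max (-x) 0 - max (-x') 0| ≤ |x - x'| :=
    (hmax _ _).trans (by rw [neg_sub_neg, abs_sub_comm])
  have h₃ : |y * c - y' * c'| ≤ B * D + |y - y'| := by
    calc |y * c - y' * c'| = |y * (c - c') + (y - y') * c'| := by ring_nf
      _ ≤ |y| * |c - c'| + |y - y'| * |c'| := by
        rw [← abs_mul, ← abs_mul]; exact abs_add_le _ _
      _ ≤ B * D + |y - y'| * 1 := by gcongr
      _ = _ := by ring
  have h₄ : |max (y' - x') 0 - max (-x') 0| ≤ |y'| := (hmax _ _).trans (by ring_nf; rfl)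
  have h₅ : |y' * c'| ≤ |y'| := by
    rw [abs_mul]; exact mul_le_of_le_one_right (abs_nonneg _) hc'
  set F := max (y - x) 0
  set F' := max (y' - x') 0
  set G := max (-x) 0
  set G' := max (-x') 0
  have hH' : |F' - G' - y' * c'| ≤ 2 * B :=
    (abs_sub _ _).trans (by linarith)
  have hHH : |(F - G - y * c) - (F' - G' - y' * c')| ≤ 2 * |y - y'| + (2 + B) * D := by
    calc |(F - G - y * c) - (F' - G' - y' * c')|
        = |(F - F') - (G - G') - (y * c - y' * c')| := by ring_nf
      _ ≤ |F - F'| + |G - G'| + |y * c - y' * c'| :=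
        (abs_sub _ _).trans (by gcongr; exact abs_sub _ _)
      _ ≤ _ := by linarith
  calc |z * (F - G - y * c) - z' * (F' - G' - y' * c')|
      = |z * ((F - G - y * c) - (F' - G' - y' * c')) + (z - z') * (F' - G' - y' * c')| := by
        ring_nf
    _ ≤ |z| * |(F - G - y * c) - (F' - G' - y' * c')| + |z - z'| * |F' - G' - y' * c'| := by
        rw [← abs_mul, ← abs_mul]; exact abs_add_le _ _
    _ ≤ B * (2 * |y - y'| + (2 + B) * D) + |z - z'| * (2 * B) := by gcongr
    _ ≤ _ := by nlinarith [mul_nonneg (sq_nonneg B) (abs_nonneg (y - y')),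
        mul_nonneg (sq_nonneg B) (abs_nonneg (z - z'))]

/-- Lipschitz continuity of the smoothed Knight remainder functionals on bounded sets. -/
theorem knight_remainder_smoothed_lipschitz (B : ℝ) (hB : 0 < B) :
    ∃ C : ℝ, 0 < C ∧
      ∀ δ : ℝ, 0 < δ → δ ≤ 1 →
        ∀ x x' y y' z z' : ℝ,
          |y| ≤ B → |y'| ≤ B → |z| ≤ B → |z'| ≤ B →
          |muU δ x y z - muU δ x' y' z'|
              ≤ C * (|y - y'| + |z - z'| + |x - x'| / δ) ∧
          |muL δ x y z - muL δ x' y' z'|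
              ≤ C * (|y - y'| + |z - z'| + |x - x'| / δ) := by
  refine ⟨2 * B + B ^ 2, by positivity, fun δ hδ hδ1 x x' y y' z z' hy hy' hz _ => ⟨?_, ?_⟩⟩
  · refine abs_mul_integral_sub_le hδ hδ1 hy hy' hz ?_ ?_ <;> rw [indU_eq_indL hδ]
    · exact abs_indL_le_one hδ _
    · rw [indU_eq_indL hδ]
      simpa using abs_indL_sub_le hδ (x + δ) (x' + δ)
  · exact abs_mul_integral_sub_le hδ hδ1 hy hy' hz (abs_indL_le_one hδ _) (abs_indL_sub_le hδ _ _)
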